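/- For every integer k ≥ 0, the space P_k(ℝ³;𝕊) is the internal direct sum of the subspace { def v : v ∈ P_{k+1}(ℝ³;ℝ³) } and the subspace { x ↦ x×(σ(x)×x) : σ ∈ P_{k-2}(ℝ³;𝕊) }. -/

import Mathlib

open Matrix

noncomputable section

abbrev V3 : Type := Fin 3 → ℝ
abbrev M3 : Type := Matrix (Fin 3) (Fin 3) ℝ

/-- The Levi-Civita symbol `ε i j k` on `Fin 3`. -/
def eps (i j k : Fin 3) : ℝ :=
  ((((j : ℤ) - (i : ℤ)) * ((k : ℤ) - (j : ℤ)) * ((k : ℤ) - (i : ℤ)) : ℤ) : ℝ) / 2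

/-- Partial derivative `∂ᵢ f`. -/
def pd (i : Fin 3) (f : V3 → ℝ) : V3 → ℝ :=
  fun x => fderiv ℝ f x (Pi.single i 1)

/-- Cross product of vectors in `ℝ³`. -/
def vcross (a b : V3) : V3 := fun i => ∑ k, ∑ l, eps i k l * a k * b l

/-- Symmetric part of a matrix, `sym B = (B + Bᵀ)/2`. -/
def symMat (B : M3) : M3 := (2:ℝ)⁻¹ • (B + Bᵀ)

/-- `(∇v)_{ij} = ∂ᵢ v_j`. -/
def gradv (v : V3 → V3) : V3 → M3 :=
  fun x => Matrix.of fun i j => pd i (fun y => v y j) x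

/-- Symmetric gradient (deformation) `def v = (∇v + (∇v)ᵀ)/2`. -/
def defv (v : V3 → V3) : V3 → M3 := fun x => symMat (gradv v x)

/-- Column-wise curl `(∇×A)_{ij} = Σ_{s,t} ε_{ist} ∂_s A_{tj}`. -/
def colCurl (A : V3 → M3) : V3 → M3 :=
  fun x => Matrix.of fun i j => ∑ s, ∑ t, eps i s t * pd s (fun y => A y t j) x

/-- Row-wise curl `(A×∇)_{ij} = Σ_{k,l} ε_{jkl} ∂_l A_{ik}`. -/
def rowCurl (A : V3 → M3) : V3 → M3 :=
  fun x => Matrix.of fun i j => ∑ k, ∑ l, eps j k l * pd l (fun y => A y i k) x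

/-- Incompatibility operator `inc A = ∇×(A×∇)`. -/
def incOp (A : V3 → M3) : V3 → M3 := colCurl (rowCurl A)

/-- Row-wise divergence `(div A)_i = Σ_j ∂_j A_{ij}`. -/
def divRow (A : V3 → M3) : V3 → V3 :=
  fun x i => ∑ j, pd j (fun y => A y i j) x

/-- Curl of a vector field. -/
def curlVec (w : V3 → V3) : V3 → V3 :=
  fun x i => ∑ s, ∑ t, eps i s t * pd s (fun y => w y t) x

/-- `(b×A)_{ij} = Σ_{k,l} ε_{ikl} b_k A_{lj}`. -/
def bCrossA (b : V3) (A : M3) : M3 :=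
  Matrix.of fun i j => ∑ k, ∑ l, eps i k l * b k * A l j

/-- `(A×b)_{ij} = Σ_{k,l} ε_{jkl} A_{ik} b_l`. -/
def aCrossB (A : M3) (b : V3) : M3 :=
  Matrix.of fun i j => ∑ k, ∑ l, eps j k l * A i k * b l

/-- `f : ℝ³ → ℝ` is a polynomial map of total degree at most `m` (`m : ℤ`, so
`m < 0` forces `f = 0` since the zero polynomial has empty support). -/
def PolyDeg (m : ℤ) (f : V3 → ℝ) : Prop :=
  ∃ p : MvPolynomial (Fin 3) ℝ,
    (∀ d ∈ p.support, ((∑ i, d i : ℕ) : ℤ) ≤ m) ∧ f = fun x => MvPolynomial.eval x p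

/-- `P_m(ℝ³;ℝ³)`. -/
def PolyVec (m : ℤ) (v : V3 → V3) : Prop := ∀ i, PolyDeg m fun x => v x i

/-- `P_m(ℝ³;𝕄)`. -/
def PolyMat (m : ℤ) (A : V3 → M3) : Prop := ∀ i j, PolyDeg m fun x => A x i j

/-- `P_m(ℝ³;𝕊)`: polynomial symmetric-matrix-valued maps of degree at most `m`. -/
def PolySym (m : ℤ) (A : V3 → M3) : Prop := PolyMat m A ∧ ∀ x, (A x)ᵀ = A x

section PolynomialComplex

open MvPolynomial

/-- Real polynomials in three variables. -/
abbrev Poly3 : Type := MvPolynomial (Fin 3) ℝ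

/-- The Euler derivation `∑ xᵢ ∂ᵢ`. -/
def euler : Derivation ℝ Poly3 Poly3 := ∑ i, (X i : Poly3) • pderiv i

lemma euler_apply (p : Poly3) :
    euler p = X 0 * pderiv 0 p + X 1 * pderiv 1 p + X 2 * pderiv 2 p := by
  simp [euler, Fin.sum_univ_three]

lemma euler_X (i : Fin 3) : euler (X i) = X i := by
  fin_cases i <;> simp [euler_apply, pderiv_X]

lemma coeff_euler (d : Fin 3 →₀ ℕ) (p : Poly3) :
    coeff d (euler p) = (d.degree : ℝ) * coeff d p := by
  induction p using MvPolynomial.induction_on' with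
  | monomial e r =>
    have h : euler (monomial e r) = (e.degree : ℝ) • monomial e r := by
      simp only [euler_apply, X_mul_pderiv_monomial, Finsupp.degree_eq_sum, Fin.sum_univ_three,
        ← add_smul, Nat.cast_smul_eq_nsmul]
    rw [h, coeff_smul, coeff_monomial, smul_eq_mul]
    split_ifs with hed
    · rw [hed]
    · simp
  | add p q hp hq => rw [map_add, coeff_add, coeff_add, hp, hq, mul_add]

lemma euler_of_isHomogeneous {p : Poly3} {m : ℕ} (hp : p.IsHomogeneous m) :
    euler p = (m : ℝ) • p := by
  ext d
  rw [coeff_euler, coeff_smul, smul_eq_mul]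
  by_cases hd : d.degree = m
  · rw [hd]
  · rw [hp.coeff_eq_zero hd, mul_zero, mul_zero]

lemma pderiv_comm (i j : Fin 3) (p : Poly3) :
    pderiv i (pderiv j p) = pderiv j (pderiv i p) := by
  rcases eq_or_ne i j with rfl | hij
  · rfl
  · ext d
    simp only [coeff_pderiv, Finsupp.add_apply, Finsupp.single_eq_of_ne hij,
      Finsupp.single_eq_of_ne hij.symm]
    rw [add_right_comm d]
    ring_nf

/-- If `E (E p + p) = 0` for the Euler derivation `E`, then `p` is constant. -/
lemma pderiv_eq_zero_of_euler {p : Poly3} (h : euler (euler p + p) = 0) (i : Fin 3) :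
    pderiv i p = 0 := by
  have hp : p = C (coeff 0 p) := by
    ext d
    rw [coeff_C]
    split_ifs with hd
    · rw [hd]
    · have h1 := congrArg (coeff d) h
      rw [coeff_euler, coeff_add, coeff_euler, coeff_zero] at h1
      have h2 : (0 : ℝ) < d.degree := by
        exact_mod_cast Nat.pos_of_ne_zero fun h0 => hd ((Finsupp.degree_eq_zero_iff d).1 h0).symm
      have h3 : ((d.degree : ℝ) * (d.degree + 1)) * coeff d p = 0 := by linear_combination h1
      exact (mul_eq_zero.1 h3).resolve_left (by positivity)
  rw [hp, pderiv_C]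

/-- Polynomials all of whose monomials have degree at most `m`. -/
def degLE (m : ℤ) : Submodule ℝ Poly3 :=
  restrictSupport ℝ {d | ((∑ i, d i : ℕ) : ℤ) ≤ m}

lemma mem_degLE {m : ℤ} {p : Poly3} :
    p ∈ degLE m ↔ ∀ d, ((∑ i, d i : ℕ) : ℤ) ≤ m ∨ coeff d p = 0 := by
  simp only [degLE, mem_restrictSupport_iff, Set.subset_def, Finset.mem_coe, mem_support_iff,
    Set.mem_ofPred_eq]
  exact forall_congr' fun d => by tauto

lemma pderiv_mem_degLE {m : ℤ} {p : Poly3} (hp : p ∈ degLE m) (i : Fin 3) :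
    pderiv i p ∈ degLE (m - 1) := by
  rw [mem_degLE] at hp ⊢
  intro d
  rw [coeff_pderiv]
  refine (hp (d + Finsupp.single i 1)).imp (fun h => ?_) fun h => by rw [h, zero_mul]
  simp only [Finsupp.add_apply, Finset.sum_add_distrib, Finsupp.single_apply, Finset.sum_ite_eq,
    Finset.mem_univ, if_true] at h
  push_cast at h ⊢
  linarith

lemma X_mul_mem_degLE {m : ℤ} {p : Poly3} (hp : p ∈ degLE m) (i : Fin 3) :
    X i * p ∈ degLE (m + 1) := by
  rw [mem_degLE] at hp ⊢
  intro d
  rw [coeff_X_mul']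
  split_ifs with hi
  · refine (hp (d - Finsupp.single i 1)).imp (fun h => ?_) id
    have hd : d = d - Finsupp.single i 1 + Finsupp.single i 1 :=
      (tsub_add_cancel_of_le (Finsupp.single_le_iff.2
        (Nat.one_le_iff_ne_zero.2 (Finsupp.mem_support_iff.1 hi)))).symm
    rw [hd]
    simp only [Finsupp.add_apply, Finset.sum_add_distrib, Finsupp.single_apply, Finset.sum_ite_eq,
      Finset.mem_univ, if_true]
    push_cast at h ⊢
    linarith
  · exact Or.inr rfl

lemma homogeneousComponent_mem_degLE {m : ℤ} {p : Poly3} (hp : p ∈ degLE m) (n : ℕ) :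
    homogeneousComponent n p ∈ degLE m := by
  rw [mem_degLE] at hp ⊢
  intro d
  rw [coeff_homogeneousComponent]
  refine (hp d).imp id fun h => ?_
  rw [h, ite_self]

/-- Polynomial vector fields. -/
abbrev PVec : Type := Fin 3 → Poly3

/-- Polynomial matrix fields. -/
abbrev PMat : Type := Matrix (Fin 3) (Fin 3) Poly3

/-- The Koszul map `a ↦ x × a` on polynomial vector fields. -/
def crossX : PVec →ₗ[ℝ] PVec where
  toFun a := ![X 1 * a 2 - X 2 * a 1, X 2 * a 0 - X 0 * a 2, X 0 * a 1 - X 1 * a 0]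
  map_add' a b := by ext1 i; fin_cases i <;> simp <;> ring
  map_smul' c a := by ext1 i; fin_cases i <;> simp [smul_sub]

/-- The curl of a polynomial vector field. -/
def pcurl : PVec →ₗ[ℝ] PVec where
  toFun a := ![pderiv 1 (a 2) - pderiv 2 (a 1), pderiv 2 (a 0) - pderiv 0 (a 2),
    pderiv 0 (a 1) - pderiv 1 (a 0)]
  map_add' a b := by ext1 i; fin_cases i <;> simp <;> ring
  map_smul' c a := by ext1 i; fin_cases i <;> simp [smul_sub]

/-- Apply a map of vector fields to each row of a matrix field. -/
def onRows (f : PVec →ₗ[ℝ] PVec) : PMat →ₗ[ℝ] PMat where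
  toFun A := Matrix.of fun i => f (A i)
  map_add' A B := by ext1 i; exact fun j => congrFun (map_add f (A i) (B i)) j
  map_smul' c A := by ext1 i; exact fun j => congrFun (map_smul f c (A i)) j

/-- Apply a map of vector fields to each column of a matrix field. -/
def onCols (f : PVec →ₗ[ℝ] PVec) : PMat →ₗ[ℝ] PMat where
  toFun A := (onRows f Aᵀ)ᵀ
  map_add' A B := by simp
  map_smul' c A := by simp

lemma onRows_apply (f : PVec →ₗ[ℝ] PVec) (A : PMat) (i j : Fin 3) :
    onRows f A i j = f (A i) j := rfl

lemma onCols_apply (f : PVec →ₗ[ℝ] PVec) (A : PMat) (i j : Fin 3) :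
    onCols f A i j = f (fun l => A l j) i := rfl

lemma crossX_comm (A : PMat) :
    onCols crossX (onRows crossX A) = onRows crossX (onCols crossX A) := by
  ext1 i j
  fin_cases i <;> fin_cases j <;> simp [onRows_apply, onCols_apply, crossX] <;> ring

lemma pcurl_comm (A : PMat) :
    onCols pcurl (onRows pcurl A) = onRows pcurl (onCols pcurl A) := by
  ext1 i j
  fin_cases i <;> fin_cases j <;>
    simp [onRows_apply, onCols_apply, pcurl, pderiv_comm 1 0, pderiv_comm 2 0, pderiv_comm 2 1] <;>
    ring

/-- Cartan's homotopy formula for vector fields orthogonal to the position vector. -/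
lemma crossX_pcurl {a : PVec} (h : X 0 * a 0 + X 1 * a 1 + X 2 * a 2 = 0) (i : Fin 3) :
    crossX (pcurl a) i = -(euler (a i) + a i) := by
  have h' := congrArg (pderiv i) h
  fin_cases i <;>
    simp [crossX, pcurl, euler_apply, pderiv_X] at h' ⊢ <;>
    linear_combination h'

lemma euler_crossX (a : PVec) (i : Fin 3) :
    euler (crossX a i) = crossX (fun l => euler (a l) + a l) i := by
  fin_cases i <;> simp [crossX, euler_X] <;> ring

/-- The symmetric gradient of a polynomial vector field. -/
def pdef : PVec →ₗ[ℝ] PMat where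
  toFun v := (2 : ℝ)⁻¹ • Matrix.of fun i j => pderiv i (v j) + pderiv j (v i)
  map_add' v w := by
    rw [← smul_add]
    congr 1
    ext1 i j
    simp only [Matrix.of_apply, Matrix.add_apply, Pi.add_apply, map_add]
    ring
  map_smul' c v := by
    rw [RingHom.id_apply, smul_comm c]
    congr 1
    ext1 i j
    simp

lemma pdef_apply (v : PVec) (i j : Fin 3) :
    pdef v i j = (2 : ℝ)⁻¹ • (pderiv i (v j) + pderiv j (v i)) := rfl

/-- The Koszul map `σ ↦ x × (σ × x)`. -/
def koszul : PMat →ₗ[ℝ] PMat := -(onCols crossX ∘ₗ onRows crossX)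

/-- Minus the incompatibility operator on polynomial matrix fields. -/
def pinc : PMat →ₗ[ℝ] PMat := onCols pcurl ∘ₗ onRows pcurl

lemma onCols_transpose (f : PVec →ₗ[ℝ] PVec) (A : PMat) : onCols f Aᵀ = (onRows f A)ᵀ := rfl

lemma onRows_transpose (f : PVec →ₗ[ℝ] PVec) (A : PMat) : onRows f Aᵀ = (onCols f A)ᵀ := rfl

lemma transpose_koszul (A : PMat) : (koszul A)ᵀ = koszul Aᵀ := by
  simp only [koszul, LinearMap.neg_apply, LinearMap.comp_apply, Matrix.transpose_neg]
  rw [← onRows_transpose, ← onCols_transpose, crossX_comm]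

lemma transpose_pinc (A : PMat) : (pinc A)ᵀ = pinc Aᵀ := by
  simp only [pinc, LinearMap.comp_apply]
  rw [← onRows_transpose, ← onCols_transpose, pcurl_comm]

lemma pinc_pdef (v : PVec) : pinc (pdef v) = 0 := by
  set G : PMat := Matrix.of fun i j => pderiv i (v j)
  have hG : onCols pcurl G = 0 := by
    ext1 i j
    fin_cases i <;> simp [G, onCols_apply, pcurl, pderiv_comm 1 0, pderiv_comm 2 0, pderiv_comm 2 1]
  have hd : pdef v = (2 : ℝ)⁻¹ • (G + Gᵀ) := rfl
  have h1 : pinc G = 0 := by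
    simp only [pinc, LinearMap.comp_apply]
    rw [pcurl_comm, hG, map_zero]
  rw [hd, map_smul, map_add, ← transpose_pinc, h1, Matrix.transpose_zero, add_zero, smul_zero]

lemma koszul_row_orthogonal (A : PMat) (i : Fin 3) :
    X 0 * koszul A i 0 + X 1 * koszul A i 1 + X 2 * koszul A i 2 = 0 := by
  simp only [koszul, LinearMap.neg_apply, LinearMap.comp_apply, crossX_comm, Matrix.neg_apply,
    onRows_apply]
  simp [crossX]
  ring

lemma koszul_pinc {A : PMat} (hA : Aᵀ = A)
    (h : ∀ i, X 0 * A i 0 + X 1 * A i 1 + X 2 * A i 2 = 0) (i j : Fin 3) :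
    koszul (pinc A) i j = -euler (euler (A i j) + A i j) := by
  have hs : ∀ a b, A a b = A b a := fun a b => congrFun (congrFun hA b) a
  have hcol (j : Fin 3) : X 0 * onRows pcurl A 0 j + X 1 * onRows pcurl A 1 j +
      X 2 * onRows pcurl A 2 j = 0 := by
    have h0 := fun a b => congrArg (pderiv a) (h b)
    simp [pderiv_X, Pi.single_apply] at h0
    fin_cases j <;> simp [onRows_apply, pcurl]
    · have h1 := h0 1 2
      have h2 := h0 2 1
      simp [hs 1 0, hs 2 0, hs 2 1] at h1 h2 ⊢
      linear_combination h1 - h2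
    · have h1 := h0 2 0
      have h2 := h0 0 2
      simp [hs 1 0, hs 2 0, hs 2 1] at h1 h2 ⊢
      linear_combination h1 - h2
    · have h1 := h0 0 1
      have h2 := h0 1 0
      simp [hs 1 0, hs 2 0, hs 2 1] at h1 h2 ⊢
      linear_combination h1 - h2
  have hB : onCols crossX (onCols pcurl (onRows pcurl A)) =
      -Matrix.of fun i j => euler (onRows pcurl A i j) + onRows pcurl A i j := by
    ext1 i j
    exact crossX_pcurl (a := fun l => onRows pcurl A l j) (hcol j) i
  have hK : koszul (pinc A) = onRows crossX
      (Matrix.of fun i j => euler (onRows pcurl A i j) + onRows pcurl A i j) := by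
    simp only [koszul, pinc, LinearMap.neg_apply, LinearMap.comp_apply]
    rw [crossX_comm, hB, map_neg, neg_neg]
  have hE : crossX (pcurl (A i)) j = -(euler (A i j) + A i j) := crossX_pcurl (h i) j
  rw [hK, ← map_neg, ← neg_neg (euler (A i j) + A i j), ← hE, neg_neg, euler_crossX]
  rfl

lemma eq_zero_of_pinc_eq_zero {A : PMat} (hA : Aᵀ = A)
    (h : ∀ i, X 0 * A i 0 + X 1 * A i 1 + X 2 * A i 2 = 0) (h0 : pinc A = 0) : A = 0 := by
  ext1 i j
  have hj := congrArg (pderiv j) (h i)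
  have hd (l : Fin 3) : pderiv j (A i l) = 0 := by
    refine pderiv_eq_zero_of_euler ?_ j
    rw [← neg_eq_zero, ← koszul_pinc hA h, h0, map_zero, Matrix.zero_apply]
  simp only [map_add, pderiv_mul, hd, pderiv_X] at hj
  fin_cases j <;> simpa using hj

/-- Polynomial vector fields of degree at most `m`. -/
def vecDegLE (m : ℤ) : Submodule ℝ PVec := Submodule.pi Set.univ fun _ => degLE m

/-- Symmetric polynomial matrix fields of degree at most `m`. -/
def symDegLE (m : ℤ) : Submodule ℝ PMat where
  carrier := {A | (∀ i j, A i j ∈ degLE m) ∧ Aᵀ = A}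
  add_mem' hA hB := ⟨fun i j => add_mem (hA.1 i j) (hB.1 i j), by
    rw [Matrix.transpose_add, hA.2, hB.2]⟩
  zero_mem' := ⟨fun _ _ => zero_mem _, Matrix.transpose_zero⟩
  smul_mem' c A hA := ⟨fun i j => Submodule.smul_mem _ c (hA.1 i j), by
    rw [Matrix.transpose_smul, hA.2]⟩

lemma mem_symDegLE {m : ℤ} {A : PMat} :
    A ∈ symDegLE m ↔ (∀ i j, A i j ∈ degLE m) ∧ Aᵀ = A := Iff.rfl

lemma mem_vecDegLE {m : ℤ} {v : PVec} : v ∈ vecDegLE m ↔ ∀ i, v i ∈ degLE m := by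
  simp [vecDegLE]

lemma crossX_mem {m : ℤ} {a : PVec} (ha : ∀ i, a i ∈ degLE m) (i : Fin 3) :
    crossX a i ∈ degLE (m + 1) := by
  fin_cases i <;> exact sub_mem (X_mul_mem_degLE (ha _) _) (X_mul_mem_degLE (ha _) _)

lemma pcurl_mem {m : ℤ} {a : PVec} (ha : ∀ i, a i ∈ degLE m) (i : Fin 3) :
    pcurl a i ∈ degLE (m - 1) := by
  fin_cases i <;> exact sub_mem (pderiv_mem_degLE (ha _) _) (pderiv_mem_degLE (ha _) _)

lemma koszul_mem {m : ℤ} {A : PMat} (hA : A ∈ symDegLE (m - 2)) : koszul A ∈ symDegLE m := by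
  refine ⟨fun i j => neg_mem ?_, by rw [transpose_koszul, hA.2]⟩
  have h := crossX_mem (fun l => crossX_mem (hA.1 l) j) i
  rwa [show m - 2 + 1 + 1 = m by ring] at h

lemma pinc_mem {m : ℤ} {A : PMat} (hA : A ∈ symDegLE m) : pinc A ∈ symDegLE (m - 2) := by
  refine ⟨fun i j => ?_, by rw [transpose_pinc, hA.2]⟩
  have h := pcurl_mem (fun l => pcurl_mem (hA.1 l) j) i
  rwa [show m - 1 - 1 = m - 2 by ring] at h

lemma pdef_mem {m : ℤ} {v : PVec} (hv : v ∈ vecDegLE (m + 1)) : pdef v ∈ symDegLE m := by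
  rw [mem_vecDegLE] at hv
  constructor
  · intro i j
    rw [pdef_apply]
    refine Submodule.smul_mem _ _ (add_mem ?_ ?_)
    · simpa using pderiv_mem_degLE (hv j) i
    · simpa using pderiv_mem_degLE (hv i) j
  · ext1 i j
    rw [Matrix.transpose_apply, pdef_apply, pdef_apply, add_comm]

lemma pdef_isHomogeneous {m : ℕ} {v : PVec} (hv : ∀ i, (v i).IsHomogeneous (m + 1))
    (i j : Fin 3) : (pdef v i j).IsHomogeneous m :=
  (homogeneousSubmodule (Fin 3) ℝ m).smul_mem _ ((hv j).pderiv.add (hv i).pderiv)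

/-- The product of a matrix field with the position vector. -/
def mulX (A : PMat) : PVec := fun i => X 0 * A i 0 + X 1 * A i 1 + X 2 * A i 2

lemma mulX_mem {m : ℤ} {A : PMat} (hA : A ∈ symDegLE m) : mulX A ∈ vecDegLE (m + 1) :=
  mem_vecDegLE.2 fun _ => add_mem (add_mem (X_mul_mem_degLE (hA.1 _ _) _)
    (X_mul_mem_degLE (hA.1 _ _) _)) (X_mul_mem_degLE (hA.1 _ _) _)

lemma mulX_isHomogeneous {m : ℕ} {A : PMat} (hA : ∀ i j, (A i j).IsHomogeneous m) (i : Fin 3) :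
    (mulX A i).IsHomogeneous (m + 1) := by
  rw [add_comm]
  exact (((isHomogeneous_X ℝ 0).mul (hA i 0)).add ((isHomogeneous_X ℝ 1).mul (hA i 1))).add
    ((isHomogeneous_X ℝ 2).mul (hA i 2))

/-- A homogeneous symmetric matrix field of positive degree agrees with a symmetric gradient up
to a matrix field annihilating the position vector. -/
lemma exists_mulX_pdef {k : ℤ} {m : ℕ} (hm : 0 < m) {τ : PMat} (hτ : τ ∈ symDegLE k)
    (hh : ∀ i j, (τ i j).IsHomogeneous m) :
    ∃ v ∈ vecDegLE (k + 1), (∀ i, (v i).IsHomogeneous (m + 1)) ∧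
      ∀ i, mulX (pdef v) i = mulX τ i := by
  have hwdeg := mem_vecDegLE.1 (mulX_mem hτ)
  have hwhom := mulX_isHomogeneous hh
  generalize mulX τ = w at hwdeg hwhom ⊢
  set S : Poly3 := X 0 * w 0 + X 1 * w 1 + X 2 * w 2 with hS
  set φ : Poly3 := C ((m : ℝ) + 1)⁻¹ * S with hφ
  set v : PVec := fun i => C (m : ℝ)⁻¹ * (C 2 * w i - pderiv i φ) with hv
  have hSdeg : S ∈ degLE (k + 1 + 1) := add_mem (add_mem (X_mul_mem_degLE (hwdeg _) _)
    (X_mul_mem_degLE (hwdeg _) _)) (X_mul_mem_degLE (hwdeg _) _)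
  have hShom : S.IsHomogeneous (1 + (m + 1)) :=
    (((isHomogeneous_X ℝ 0).mul (hwhom 0)).add ((isHomogeneous_X ℝ 1).mul (hwhom 1))).add
      ((isHomogeneous_X ℝ 2).mul (hwhom 2))
  have hφhom := hShom.C_mul ((m : ℝ) + 1)⁻¹
  have hdeg : 1 + (m + 1) - 1 = m + 1 := by omega
  have hvhom (i : Fin 3) : (v i).IsHomogeneous (m + 1) :=
    (((hwhom i).C_mul 2).sub (hdeg ▸ hφhom.pderiv (i := i))).C_mul _
  have hφE := euler_of_isHomogeneous hφhom
  have hvE (i : Fin 3) := euler_of_isHomogeneous (hvhom i)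
  have hm0 : C (m : ℝ) * C (m : ℝ)⁻¹ = (1 : Poly3) := by
    rw [← C_mul, mul_inv_cancel₀ (by positivity), C_1]
  have hm1 : (C (m : ℝ) + 1) * C ((m : ℝ) + 1)⁻¹ = (1 : Poly3) := by
    rw [← C_1, ← C_add, ← C_mul, mul_inv_cancel₀ (by positivity)]
  have h2 : C 2 * C (2 : ℝ)⁻¹ = (1 : Poly3) := by
    rw [← C_mul, mul_inv_cancel₀ two_ne_zero, C_1]
  have h2' : (C 2 : Poly3) = 2 := map_ofNat C 2
  rw [← hφ] at hφE
  simp only [smul_eq_C_mul, Nat.cast_add, Nat.cast_one, C_add, C_1] at hφE hvE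
  have hxv : X 0 * v 0 + X 1 * v 1 + X 2 * v 2 = φ := by
    rw [euler_apply] at hφE
    simp only [hv, h2']
    linear_combination (-C (m : ℝ)⁻¹) * hφE + φ * hm0 - 2 * C (m : ℝ)⁻¹ * S * hm1
  refine ⟨v, mem_vecDegLE.2 fun i => ?_, hvhom, fun i => ?_⟩
  · simp only [hv, hφ, ← smul_eq_C_mul]
    refine Submodule.smul_mem _ _ (sub_mem (Submodule.smul_mem _ _ (hwdeg i)) ?_)
    simpa using pderiv_mem_degLE (Submodule.smul_mem _ ((m : ℝ) + 1)⁻¹ hSdeg) i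
  · have hd := congrArg (pderiv i) hxv
    have hE := hvE i
    have hvi : v i = C (m : ℝ)⁻¹ * (C 2 * w i - pderiv i φ) := rfl
    rw [euler_apply] at hE
    simp only [map_add, pderiv_mul, pderiv_X] at hd
    simp only [mulX, pdef_apply, smul_eq_C_mul]
    have key : pderiv i (X 0 : Poly3) * v 0 + pderiv i (X 1 : Poly3) * v 1 +
        pderiv i (X 2 : Poly3) * v 2 = v i := by
      fin_cases i <;> simp [pderiv_X]
    simp only [pderiv_X] at key
    linear_combination C (2 : ℝ)⁻¹ * hd - C (2 : ℝ)⁻¹ * key + C (2 : ℝ)⁻¹ * hE +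
      C (2 : ℝ)⁻¹ * C (m : ℝ) * hvi + C (2 : ℝ)⁻¹ * (C 2 * w i - pderiv i φ) * hm0 + w i * h2

lemma homogeneous_mem_sup {k : ℤ} {m : ℕ} {τ : PMat} (hτ : τ ∈ symDegLE k)
    (hm : ∀ i j, (τ i j).IsHomogeneous m) :
    τ ∈ (vecDegLE (k + 1)).map pdef ⊔ (symDegLE (k - 2)).map koszul := by
  rcases Nat.eq_zero_or_pos m with rfl | hpos
  · refine Submodule.mem_sup_left ⟨mulX τ, mulX_mem hτ, ?_⟩
    have hd (a i j : Fin 3) : pderiv a (τ i j) = 0 :=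
      pderiv_eq_zero_of_euler (by simp [euler_of_isHomogeneous (hm i j)]) a
    have hw (i j : Fin 3) : pderiv i (mulX τ j) = τ j i := by
      fin_cases i <;> simp [mulX, pderiv_X, hd]
    ext1 i j
    rw [pdef_apply, hw, hw, show τ j i = τ i j from congrFun (congrFun hτ.2 i) j, ← two_smul ℝ,
      smul_smul, inv_mul_cancel₀ two_ne_zero, one_smul]
  · obtain ⟨v, hv, hvhom, hvx⟩ := exists_mulX_pdef hpos hτ hm
    set ρ : PMat := τ - pdef v with hρ
    have hρdeg : ρ ∈ symDegLE k := sub_mem hτ (pdef_mem hv)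
    have hρE (i j : Fin 3) : euler (ρ i j) = (m : ℝ) • ρ i j :=
      euler_of_isHomogeneous ((hm i j).sub (pdef_isHomogeneous hvhom i j))
    have hρx (i : Fin 3) : X 0 * ρ i 0 + X 1 * ρ i 1 + X 2 * ρ i 2 = 0 := by
      have h := hvx i
      simp only [mulX] at h
      simp only [hρ, Matrix.sub_apply]
      linear_combination -h
    have hK : koszul (-((m : ℝ) * (m + 1))⁻¹ • pinc ρ) = ρ := by
      ext1 i j
      have hc : ((m : ℝ) * (m + 1))⁻¹ * (m * (m + 1)) = 1 := inv_mul_cancel₀ (by positivity)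
      rw [map_smul, Matrix.smul_apply, koszul_pinc hρdeg.2 hρx, map_add, hρE, Derivation.map_smul,
        hρE]
      conv_rhs => rw [← one_smul ℝ (ρ i j), ← hc]
      module
    refine Submodule.mem_sup.2 ⟨pdef v, ⟨v, hv, rfl⟩, ρ,
      ⟨_, Submodule.smul_mem _ _ (pinc_mem hρdeg), hK⟩, ?_⟩
    rw [hρ, add_sub_cancel]

theorem pdef_inf_koszul (k : ℤ) :
    (vecDegLE (k + 1)).map pdef ⊓ (symDegLE (k - 2)).map koszul = ⊥ := by
  rw [eq_bot_iff]
  rintro _ ⟨⟨v, hv, rfl⟩, σ, -, hσ⟩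
  refine (Submodule.mem_bot ℝ).2 (eq_zero_of_pinc_eq_zero (pdef_mem hv).2 (fun i => ?_)
    (pinc_pdef v))
  rw [← hσ, koszul_row_orthogonal]

theorem pdef_sup_koszul (k : ℤ) :
    (vecDegLE (k + 1)).map pdef ⊔ (symDegLE (k - 2)).map koszul = symDegLE k := by
  refine le_antisymm (sup_le ?_ ?_) fun τ hτ => ?_
  · rintro _ ⟨v, hv, rfl⟩
    exact pdef_mem hv
  · rintro _ ⟨σ, hσ, rfl⟩
    exact koszul_mem hσ
  · set N : ℕ := (∑ i, ∑ j, (τ i j).totalDegree) + 1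
    have hsum : τ = ∑ n ∈ Finset.range N, τ.map (homogeneousComponent n) := by
      ext1 i j
      have hN : (τ i j).totalDegree + 1 ≤ N := Nat.succ_le_succ <|
        (Finset.single_le_sum (f := fun j => (τ i j).totalDegree) (fun _ _ => Nat.zero_le _)
          (Finset.mem_univ j)).trans
        (Finset.single_le_sum (f := fun i => ∑ j, (τ i j).totalDegree) (fun _ _ => Nat.zero_le _)
          (Finset.mem_univ i))
      rw [Matrix.sum_apply]
      simp only [Matrix.map_apply]
      rw [← Finset.sum_subset (Finset.range_subset_range.2 hN), sum_homogeneousComponent]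
      exact fun n _ hn => homogeneousComponent_eq_zero _ _ (by simpa using hn)
    rw [hsum]
    refine sum_mem fun n _ => homogeneous_mem_sup (m := n) ⟨fun i j => ?_, ?_⟩ fun i j => ?_
    · exact homogeneousComponent_mem_degLE (hτ.1 i j) n
    · rw [← Matrix.transpose_map, hτ.2]
    · exact homogeneousComponent_isHomogeneous n _

/-- The matrix-valued function of a polynomial matrix field. -/
def evalMat : PMat →ₗ[ℝ] V3 → M3 where
  toFun A := fun x => Matrix.of fun i j => eval x (A i j)
  map_add' A B := by ext; simp
  map_smul' c A := by ext; simp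

lemma evalMat_apply (A : PMat) (x : V3) (i j : Fin 3) : evalMat A x i j = eval x (A i j) := rfl

lemma evalMat_injective : Function.Injective evalMat := by
  intro A B h
  ext1 i j
  exact MvPolynomial.funext fun x => congrFun (congrFun (congrFun h x) i) j

lemma hasFDerivAt_eval (p : Poly3) (x : V3) :
    HasFDerivAt (fun y : V3 => eval y p)
      (∑ i, eval x (pderiv i p) • (ContinuousLinearMap.proj i : V3 →L[ℝ] ℝ)) x := by
  induction p using MvPolynomial.induction_on with
  | C a => simpa using hasFDerivAt_const a x
  | add p q hp hq =>
    simp only [map_add]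
    exact (hp.add hq).congr_fderiv (by simp [add_smul, Finset.sum_add_distrib])
  | mul_X p i hp =>
    have h := hp.mul (ContinuousLinearMap.proj i : V3 →L[ℝ] ℝ).hasFDerivAt (x := x)
    simp only [map_mul, eval_X]
    refine h.congr_fderiv ?_
    ext j
    simp [pderiv_X, Pi.single_apply, apply_ite (eval x), ite_mul, add_mul, Finset.sum_add_distrib,
      Finset.mul_sum, mul_assoc]

lemma pd_eval (p : Poly3) (i : Fin 3) :
    pd i (fun y => eval y p) = fun x => eval x (pderiv i p) := by
  funext x
  rw [pd, (hasFDerivAt_eval p x).fderiv]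
  simp [Pi.single_apply]

lemma polyDeg_iff {m : ℤ} {f : V3 → ℝ} :
    PolyDeg m f ↔ ∃ p ∈ degLE m, f = fun x => eval x p := Iff.rfl

lemma defv_eval (v : PVec) : defv (fun x i => eval x (v i)) = evalMat (pdef v) := by
  ext x i j
  simp [defv, symMat, gradv, pd_eval, evalMat_apply, pdef_apply, mul_add]

lemma bCrossA_eval (A : PMat) :
    (fun x => bCrossA x (aCrossB (evalMat A x) x)) = evalMat (koszul A) := by
  ext x i j
  simp only [bCrossA, aCrossB, Matrix.of_apply, evalMat_apply, koszul, LinearMap.neg_apply,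
    LinearMap.comp_apply, Matrix.neg_apply, onCols_apply, onRows_apply, Fin.sum_univ_three]
  fin_cases i <;> fin_cases j <;> simp [eps, crossX] <;> ring

lemma setOf_defv (m : ℤ) :
    {g : V3 → M3 | ∃ v : V3 → V3, PolyVec m v ∧ g = defv v} =
      ((vecDegLE m).map pdef).map evalMat := by
  ext g
  constructor
  · rintro ⟨v, hv, rfl⟩
    choose p hp hvp using fun i => polyDeg_iff.1 (hv i)
    refine ⟨pdef p, ⟨p, mem_vecDegLE.2 hp, rfl⟩, ?_⟩
    rw [← defv_eval]
    congr 1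
    ext x i
    exact (congrFun (hvp i) x).symm
  · rintro ⟨_, ⟨p, hp, rfl⟩, rfl⟩
    exact ⟨_, fun i => ⟨p i, mem_vecDegLE.1 hp i, rfl⟩, (defv_eval p).symm⟩

lemma polySym_iff {m : ℤ} {τ : V3 → M3} : PolySym m τ ↔ ∃ A ∈ symDegLE m, evalMat A = τ := by
  constructor
  · rintro ⟨hτ, hsymm⟩
    choose p hp hτp using fun i j => polyDeg_iff.1 (hτ i j)
    refine ⟨Matrix.of p, ⟨hp, ?_⟩, ?_⟩
    · ext1 i j
      refine MvPolynomial.funext fun x => ?_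
      exact ((congrFun (hτp j i) x).symm.trans (congrFun (congrFun (hsymm x) i) j)).trans
        (congrFun (hτp i j) x)
    · ext x i j
      exact (congrFun (hτp i j) x).symm
  · rintro ⟨A, hA, rfl⟩
    refine ⟨fun i j => ⟨A i j, hA.1 i j, rfl⟩, fun x => ?_⟩
    ext i j
    rw [Matrix.transpose_apply, evalMat_apply, evalMat_apply, ← congrFun (congrFun hA.2 i) j,
      Matrix.transpose_apply]

lemma setOf_koszul (m : ℤ) :
    {g : V3 → M3 | ∃ σ : V3 → M3, PolySym m σ ∧ g = fun x => bCrossA x (aCrossB (σ x) x)} =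
      ((symDegLE m).map koszul).map evalMat := by
  ext g
  constructor
  · rintro ⟨σ, hσ, rfl⟩
    obtain ⟨A, hA, rfl⟩ := polySym_iff.1 hσ
    exact ⟨koszul A, ⟨A, hA, rfl⟩, (bCrossA_eval A).symm⟩
  · rintro ⟨_, ⟨A, hA, rfl⟩, rfl⟩
    exact ⟨evalMat A, polySym_iff.2 ⟨A, hA, rfl⟩, (bCrossA_eval A).symm⟩

lemma setOf_polySym (m : ℤ) :
    {τ : V3 → M3 | PolySym m τ} = (symDegLE m).map evalMat :=
  Set.ext fun _ => polySym_iff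

end PolynomialComplex

/-- `P_k(ℝ³;𝕊) = def P_{k+1}(ℝ³;ℝ³) ⊕ {x×(σ(x)×x) : σ ∈ P_{k-2}(ℝ³;𝕊)}`. -/
theorem stmt_10 (k : ℕ) :
    (Submodule.span ℝ
        {g : V3 → M3 | ∃ v : V3 → V3, PolyVec ((k : ℤ) + 1) v ∧ g = defv v}) ⊓
      (Submodule.span ℝ
        {g : V3 → M3 | ∃ σ : V3 → M3, PolySym ((k : ℤ) - 2) σ ∧
          g = fun x => bCrossA x (aCrossB (σ x) x)}) = ⊥ ∧
    (Submodule.span ℝ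
        {g : V3 → M3 | ∃ v : V3 → V3, PolyVec ((k : ℤ) + 1) v ∧ g = defv v}) ⊔
      (Submodule.span ℝ
        {g : V3 → M3 | ∃ σ : V3 → M3, PolySym ((k : ℤ) - 2) σ ∧
          g = fun x => bCrossA x (aCrossB (σ x) x)})
      = Submodule.span ℝ {τ : V3 → M3 | PolySym k τ} := by
  rw [setOf_defv, setOf_koszul, setOf_polySym, Submodule.span_eq, Submodule.span_eq,
    Submodule.span_eq, ← Submodule.map_inf _ evalMat_injective, pdef_inf_koszul, Submodule.map_bot,
    ← Submodule.map_sup, pdef_sup_koszul]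
  exact ⟨rfl, rfl⟩
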